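/- arXiv:1610.05684 — 5 statements merged into one kernel-verified Lean document; each statement's English description precedes it below -/
import Mathlib

section
/- Let F be a field of characteristic p (p prime), let γ ∈ F be an element with γ^p − γ ≠ 0 (e.g., a proper element of F_{q^n} not lying in the prime field), and let θ be a nonzero element of the prime field F_p ⊆ F. Then ∑_{j=0}^{p−1} 1/(γ + jθ) = −1/(γ^p − γ). -/
/-- Lemma 2.1: In a field `F` of characteristic `p`, if `γ^p - γ ≠ 0`
and `θ` is a nonzero element of the prime field `F_p` (i.e. `θ ≠ 0` and `θ^p = θ`),
then `∑_{j=0}^{p-1} 1/(γ + jθ) = -1/(γ^p - γ)`. -/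
theorem sum_inv_shifts_eq_neg_inv_artinSchreier
    {F : Type*} [Field F] (p : ℕ) (hp : p.Prime) [CharP F p]
    (γ θ : F) (hγ : γ ^ p - γ ≠ 0) (hθ : θ ≠ 0) (hθp : θ ^ p = θ) :
    ∑ j ∈ Finset.range p, (γ + (j : F) * θ)⁻¹ = -(γ ^ p - γ)⁻¹ := by
  haveI : Fact p.Prime := ⟨hp⟩
  have hdeg := FiniteField.X_pow_card_sub_X_natDegree_eq F hp.one_lt
  have hne := FiniteField.X_pow_card_sub_X_ne_zero F hp.one_lt
  set f : Polynomial F := Polynomial.X ^ p - Polynomial.X with hf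
  have hle : (Finset.range p).val.map (fun j : ℕ => -((j : F) * θ)) ≤ f.roots := by
    rw [Multiset.le_iff_subset]
    · intro x hx
      obtain ⟨j, -, rfl⟩ := Multiset.mem_map.1 hx
      rw [Polynomial.mem_roots hne]
      have h1 : ((j : F)) ^ p = j := by
        have := map_natCast (frobenius F p) j
        rwa [frobenius_def] at this
      have h2 : (-((j : F) * θ)) ^ p = -((j : F) * θ) := by
        have := map_neg (frobenius F p) ((j : F) * θ)
        rw [frobenius_def, frobenius_def, mul_pow, h1, hθp] at this
        exact this
      simp only [hf, Polynomial.IsRoot, Polynomial.eval_sub, Polynomial.eval_pow,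
        Polynomial.eval_X, h2, sub_self]
    · refine Multiset.Nodup.map_on ?_ (Finset.range p).nodup
      intro a ha b hb hab
      have h3 : (a : F) = b := mul_right_cancel₀ hθ (neg_injective hab)
      exact CharP.natCast_injOn_Iio F p (by simpa using ha) (by simpa using hb) h3
  have hroots : (Finset.range p).val.map (fun j : ℕ => -((j : F) * θ)) = f.roots := by
    apply Multiset.eq_of_le_of_card_le hle
    have := f.card_roots'
    rw [hdeg] at this
    simpa using this
  have hs : f.Splits := by
    rw [Polynomial.splits_iff_card_roots, ← hroots, hdeg]
    simp
  have hx : f.eval γ ≠ 0 := by simpa [hf] using hγ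
  have key := hs.eval_derivative_div_eval_of_ne_zero hx
  rw [← hroots, Multiset.map_map] at key
  simp [hf, Polynomial.derivative_X_pow] at key
  rw [Finset.sum, Finset.range_val, ← key, neg_div, one_div]
end

section
/- Let F be a field of characteristic p (p prime), let γ ∈ F be an element with γ ∉ F_p, and let θ be a nonzero element of the prime field F_p ⊆ F. Then ∑_{j=0}^{p−1} (γ + jθ)^{p−1} = −1. -/
theorem aux_sum_range (p : ℕ) [Fact p.Prime] (f : ZMod p → ZMod p) :
    ∑ j ∈ Finset.range p, f (j : ZMod p) = ∑ x : ZMod p, f x := by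
  refine Finset.sum_bij' (fun j _ => (j : ZMod p)) (fun x _ => x.val) ?_ ?_ ?_ ?_ ?_
  · intros; simp
  · intro x _; simpa using ZMod.val_lt x
  · intro j hj; exact ZMod.val_cast_of_lt (by simpa using hj)
  · intro x _; simp
  · intros; rfl

theorem aux_pow_sum (p : ℕ) [Fact p.Prime] (m : ℕ) (hm : m < p) :
    ∑ j ∈ Finset.range p, (j : ZMod p) ^ m = if m = p - 1 then -1 else 0 := by
  have h2 := (Fact.out : p.Prime).two_le
  rw [aux_sum_range p (fun x => x ^ m)]
  split_ifs with h
  · subst h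
    have : ∀ x : ZMod p, x ^ (p - 1) = 1 - if x = 0 then 1 else 0 := by
      intro x
      split_ifs with hx
      · subst hx; rw [zero_pow (by omega)]; simp
      · rw [ZMod.pow_card_sub_one_eq_one hx]; simp
    simp [this, Finset.sum_sub_distrib]
  · apply FiniteField.sum_pow_lt_card_sub_one
    rw [ZMod.card]; omega

/-- key identity in the proof of Lemma 2.1: In a field `F` of
characteristic `p`, if `γ ∉ F_p` (i.e. `γ^p ≠ γ`) and `θ` is a nonzero element of the
prime field `F_p` (i.e. `θ ≠ 0` and `θ^p = θ`), then
`∑_{j=0}^{p-1} (γ + jθ)^(p-1) = -1`. -/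
theorem sum_shifts_pow_pred_eq_neg_one
    {F : Type*} [Field F] (p : ℕ) (hp : p.Prime) [CharP F p]
    (γ θ : F) (hγ : γ ^ p ≠ γ) (hθ : θ ≠ 0) (hθp : θ ^ p = θ) :
    ∑ j ∈ Finset.range p, (γ + (j : F) * θ) ^ (p - 1) = -1 := by
  haveI : Fact p.Prime := ⟨hp⟩
  have h2 := hp.two_le
  have hs : ∀ m < p, ∑ j ∈ Finset.range p, (j : F) ^ m = if m = p - 1 then -1 else 0 := by
    intro m hm
    have := congrArg (ZMod.castHom (dvd_refl p) F) (aux_pow_sum p m hm)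
    rw [map_sum, apply_ite (ZMod.castHom (dvd_refl p) F)] at this
    simpa only [map_pow, map_natCast, map_neg, map_one, map_zero] using this
  have hθ1 : θ ^ (p - 1) = 1 := by
    apply mul_right_cancel₀ hθ
    rw [← pow_succ, Nat.sub_add_cancel (by omega), hθp, one_mul]
  have e : ∀ j : ℕ, (γ + (j : F) * θ) ^ (p - 1) = ∑ m ∈ Finset.range p,
      (j : F) ^ m * (θ ^ m * γ ^ (p - 1 - m) * ((p - 1).choose m : F)) := by
    intro j
    rw [add_comm, add_pow, Nat.sub_add_cancel (by omega)]
    refine Finset.sum_congr rfl fun m _ => ?_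
    rw [mul_pow]; ring
  simp_rw [e]
  rw [Finset.sum_comm]
  simp_rw [← Finset.sum_mul]
  rw [Finset.sum_eq_single (p - 1)]
  · rw [hs _ (by omega)]; simp [hθ1]
  · intro m hm hne
    rw [hs m (by simpa using hm), if_neg hne, zero_mul]
  · intro h; exact absurd (Finset.mem_range.2 (by omega)) h
end

section
/- Let q = p^m with p prime. Let δ₀, δ₁ be nonzero elements of the prime field F_p ⊆ F_q with δ₀ ≠ δ₁, and suppose x^p − x + δ₀ and x^p − x + δ₁ are relatively prime in F_q[x]. Let P(x) be an irreducible polynomial of degree n ≥ 2 over F_q. Define F₀(x) = P(x) and, for k ≥ 1, F_k(x) = (x^p − x + δ₁)^{t_{k−1}} · F_{k−1}((x^p − x + δ₀)/(x^p − x + δ₁)), where t_k = n·p^k. If Tr_{q|p}( ((δ₁−δ₀)F₀′(1) − nδ₁F₀(1)) / F₀(1) ) · Tr_{q|p}( ((δ₁−δ₀)F₀′(δ₀/δ₁) + nδ₁F₀(δ₀/δ₁)) / F₀(δ₀/δ₁) ) ≠ 0, then for every k ≥ 0, F_k(x) is an irreducible polynomial of degree t_k = n·p^k over F_q. -/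
open Polynomial

/-- The trace map `Tr_{q|p} : F_q → F_p ⊆ F_q`, `Tr(x) = ∑_{i=0}^{m-1} x^{p^i}`,
valued in `F` (its image lies in the prime field). -/
def TrQP {F : Type*} [Field F] (p m : ℕ) (x : F) : F :=
  ∑ i ∈ Finset.range m, x ^ p ^ i

/-- `(x^p - x + δ₁)^t · G((x^p - x + δ₀)/(x^p - x + δ₁))` for `G` of degree `t`, i.e.
`∑_{i=0}^t g_i (x^p - x + δ₀)^i (x^p - x + δ₁)^{t-i}` where `G = ∑ g_i x^i`. -/
noncomputable def compSubst01 {F : Type*} [Field F] (p : ℕ) (δ₀ δ₁ : F) (t : ℕ)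
    (G : Polynomial F) : Polynomial F :=
  ∑ i ∈ Finset.range (t + 1), Polynomial.C (G.coeff i) *
    (X ^ p - X + C δ₀) ^ i * (X ^ p - X + C δ₁) ^ (t - i)

/-- The sequence `F₀ = P`, `F_k = (x^p-x+δ₁)^{t_{k-1}} F_{k-1}((x^p-x+δ₀)/(x^p-x+δ₁))`
with `t_k = n·p^k`. -/
noncomputable def FseqProp24 {F : Type*} [Field F] (p : ℕ) (δ₀ δ₁ : F) (n : ℕ)
    (P : Polynomial F) : ℕ → Polynomial F
  | 0 => P
  | k + 1 => compSubst01 p δ₀ δ₁ (n * p ^ k) (FseqProp24 p δ₀ δ₁ n P k)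


theorem aux_eval {F K : Type*} [Field F] [Field K] [Algebra F K] (p : ℕ) (δ₀ δ₁ : F) (t : ℕ)
    (G : F[X]) (hG : G.natDegree = t) (b : K)
    (hv : b ^ p - b + algebraMap F K δ₁ ≠ 0) :
    aeval b (compSubst01 p δ₀ δ₁ t G) = (b ^ p - b + algebraMap F K δ₁) ^ t *
      aeval ((b ^ p - b + algebraMap F K δ₀) / (b ^ p - b + algebraMap F K δ₁)) G := by
  rw [compSubst01, map_sum, aeval_eq_sum_range, hG, Finset.mul_sum]
  refine Finset.sum_congr rfl fun i hi => ?_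
  have hi' : i ≤ t := by simpa [Nat.lt_succ_iff] using hi
  simp only [map_mul, map_pow, map_add, map_sub, aeval_X, aeval_C, Algebra.smul_def]
  rw [div_pow, pow_sub₀ _ hv hi']
  field_simp

theorem aux_eval0 {F K : Type*} [Field F] [Field K] [Algebra F K] (p : ℕ) (δ₀ δ₁ : F) (t : ℕ)
    (G : F[X]) (b : K)
    (hv : b ^ p - b + algebraMap F K δ₁ = 0) :
    aeval b (compSubst01 p δ₀ δ₁ t G) =
      algebraMap F K (G.coeff t) * (b ^ p - b + algebraMap F K δ₀) ^ t := by
  rw [compSubst01, map_sum, Finset.sum_eq_single t]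
  · simp
  · intro i hi hne
    have : t - i ≠ 0 := by
      have := Finset.mem_range.1 hi
      omega
    simp [hv, this]
  · simp

theorem aux_deriv {F : Type*} [Field F] (p : ℕ) [CharP F p] (δ₀ δ₁ : F) (hδ₁ : δ₁ ≠ 0) (t : ℕ)
    (G : F[X]) (hG : G.natDegree = t) (x : F) (hx : x ^ p = x) :
    δ₁ ^ 2 * (derivative (compSubst01 p δ₀ δ₁ t G)).eval x = - δ₁ ^ t *
      ((δ₁ - δ₀) * (derivative G).eval (δ₀ / δ₁) + t * δ₁ * G.eval (δ₀ / δ₁)) := by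
  obtain ⟨r, rfl⟩ : ∃ r, δ₀ = r * δ₁ := ⟨δ₀ / δ₁, by field_simp⟩
  rw [mul_div_cancel_right₀ r hδ₁]
  have h1 : (derivative G).eval r =
      ∑ i ∈ Finset.range (t + 1), G.coeff i * i * r ^ (i - 1) := by
    rw [derivative_eval, sum_over_range' _ _ (t + 1) (by omega)]
    simp
  rw [h1, eval_eq_sum_range (p := G), hG, compSubst01, derivative_sum, eval_finsetSum, Finset.mul_sum,
    Finset.mul_sum, Finset.mul_sum, ← Finset.sum_add_distrib, Finset.mul_sum]
  refine Finset.sum_congr rfl fun i hi => ?_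
  have hi' : i ≤ t := by simpa [Nat.lt_succ_iff] using hi
  obtain ⟨j, rfl⟩ := Nat.exists_eq_add_of_le hi'
  simp only [derivative_mul, derivative_C, derivative_pow, derivative_add, derivative_sub,
    derivative_X, eval_add, eval_mul, eval_sub, eval_pow, eval_X, eval_C, eval_zero, eval_one,
    CharP.cast_eq_zero, hx, sub_self, zero_add, map_natCast, eval_natCast, zero_mul, zero_sub,
    Nat.add_sub_cancel_left]
  rcases i with _ | i <;> rcases j with _ | j <;> simp <;> ring

theorem aux_deg {F : Type*} [Field F] (p : ℕ) (hp : 2 ≤ p) (δ₀ δ₁ : F) (t : ℕ)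
    (G : F[X]) (hG : G.natDegree = t) (h1 : G.eval 1 ≠ 0) :
    (compSubst01 p δ₀ δ₁ t G).natDegree = t * p := by
  have hd : ∀ δ : F, (X ^ p - X + C δ : F[X]).natDegree = p := fun δ => by
    rw [natDegree_add_C]; exact FiniteField.X_pow_card_sub_X_natDegree_eq F (by omega)
  have hm : ∀ δ : F, (X ^ p - X + C δ : F[X]).Monic := fun δ => by
    have : (X ^ p - X + C δ : F[X]) = X ^ p - (X - C δ) := by ring
    rw [this]
    apply monic_X_pow_sub
    rw [degree_X_sub_C]
    exact_mod_cast hp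
  have hM : ∀ i, i ≤ t → ((X ^ p - X + C δ₀ : F[X]) ^ i * (X ^ p - X + C δ₁) ^ (t - i)).Monic ∧
      ((X ^ p - X + C δ₀ : F[X]) ^ i * (X ^ p - X + C δ₁) ^ (t - i)).natDegree = t * p := by
    intro i hi
    refine ⟨((hm _).pow _).mul ((hm _).pow _), ?_⟩
    rw [((hm _).pow _).natDegree_mul ((hm _).pow _), (hm _).natDegree_pow, (hm _).natDegree_pow,
      hd, hd, ← add_mul]
    congr 1; omega
  apply natDegree_eq_of_le_of_coeff_ne_zero
  · apply natDegree_sum_le_of_forall_le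
    intro i hi
    have hi' : i ≤ t := by simpa [Nat.lt_succ_iff] using hi
    rw [mul_assoc]
    exact (natDegree_C_mul_le _ _).trans (hM i hi').2.le
  · convert h1
    rw [compSubst01, finsetSum_coeff, eval_eq_sum_range, hG]
    refine Finset.sum_congr rfl fun i hi => ?_
    have hi' : i ≤ t := by simpa [Nat.lt_succ_iff] using hi
    rw [mul_assoc, coeff_C_mul, ← (hM i hi').2, (hM i hi').1.coeff_natDegree]
    simp

theorem aux_dvd {F K : Type*} [Field F] [Finite F] [Field K] [Algebra F K] (G : F[X])
    (hG : Irreducible G) (a : K) (ha : aeval a G = 0) (d : ℕ) :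
    a ^ Nat.card F ^ d = a ↔ G.natDegree ∣ d := by
  rw [hG.natDegree_dvd_iff_dvd_X_pow_card_pow_sub_X, ← hG.dvd_iff_aeval_eq_zero ha]
  simp [sub_eq_zero]

theorem aux_frob {F K : Type*} [Field F] [Fintype F] [Field K] [Algebra F K] (G : F[X]) (a : K) (s : ℕ) :
    aeval (a ^ Nat.card F ^ s) G = (aeval a G) ^ Nat.card F ^ s := by
  induction s with
  | zero => simp
  | succ s ih =>
    rw [pow_succ, pow_mul, pow_mul, ← ih, Nat.card_eq_fintype_card, ← map_pow, ← FiniteField.expand_card, expand_aeval]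

theorem aux_sum {F K : Type*} [Field F] [Fintype F] [Field K] [IsAlgClosed K] [Algebra F K]
    (G : F[X]) (hG : Irreducible G) (a : K) (ha : aeval a G = 0) (h1 : G.eval 1 ≠ 0) :
    ∑ s ∈ Finset.range G.natDegree, 1 / (1 - a ^ Nat.card F ^ s) =
      algebraMap F K ((derivative G).eval 1 / G.eval 1) := by
  have hinj : ∀ i j, i < G.natDegree → j < G.natDegree → i ≤ j →
      a ^ Nat.card F ^ i = a ^ Nat.card F ^ j → i = j := by
    intro i j hi hj hij h
    obtain ⟨k, rfl⟩ := Nat.exists_eq_add_of_le hij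
    have h2 : aeval (a ^ Nat.card F ^ i) G = 0 := by rw [aux_frob, ha, zero_pow]; simp
    rw [pow_add, pow_mul] at h
    have h3 := (aux_dvd G hG _ h2 k).1 h.symm
    rcases Nat.eq_zero_or_pos k with rfl | hk
    · rfl
    · have := Nat.le_of_dvd hk h3
      omega
  have hroots : (G.map (algebraMap F K)).roots =
      (Multiset.range G.natDegree).map fun s => a ^ Nat.card F ^ s := by
    symm
    apply Multiset.eq_of_le_of_card_le
    · rw [Multiset.le_iff_subset]
      · intro z hz
        obtain ⟨s, hs, rfl⟩ := Multiset.mem_map.1 hz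
        rw [mem_roots (map_ne_zero hG.ne_zero), IsRoot.def, eval_map_algebraMap, aux_frob, ha,
          zero_pow]
        simp
      · apply Multiset.Nodup.map_on _ (Multiset.nodup_range _)
        intro i hi j hj h
        rw [Multiset.mem_range] at hi hj
        rcases le_total i j with hij | hij
        · exact hinj i j hi hj hij h
        · exact (hinj j i hj hi hij h.symm).symm
    · refine (card_roots' _).trans ?_
      simp
  have e1 : ∀ Q : F[X], (Q.map (algebraMap F K)).eval 1 = algebraMap F K (Q.eval 1) := fun Q => by
    rw [← map_one (algebraMap F K), eval_map_apply]
  have := (IsAlgClosed.splits (G.map (algebraMap F K))).eval_derivative_div_eval_of_ne_zero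
    (x := 1) (by rw [e1]; simpa using h1)
  rw [derivative_map, e1, e1, ← map_div₀, hroots, Multiset.map_map] at this
  rw [this]
  rfl

theorem aux_tele {K : Type*} [Field K] (p e : ℕ) [Fact p.Prime] [CharP K p] (b : K) (M : ℕ) :
    b ^ (p ^ e) ^ M - b = ∑ s ∈ Finset.range M, (b ^ p ^ e - b) ^ (p ^ e) ^ s := by
  induction M with
  | zero => simp
  | succ M ih =>
    rw [Finset.sum_range_succ, ← ih, ← pow_mul p e M, sub_pow_char_pow, ← pow_mul b, ← pow_mul p,
      ← pow_add]
    ring_nf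

theorem aux_step {F : Type*} [Field F] [Fintype F] (K : Type*) [Field K] [Algebra F K]
    [IsAlgClosed K] [Algebra.IsIntegral F K] (p m t : ℕ) [Fact p.Prime] [CharP F p]
    (hq : Fintype.card F = p ^ m)
    (δ₀ δ₁ : F) (hne : δ₀ ≠ δ₁) (G : F[X]) (hG : Irreducible G) (hGt : G.natDegree = t)
    (h1 : G.eval 1 ≠ 0)
    (htr : TrQP p m (((δ₁ - δ₀) * (derivative G).eval 1 - (t : F) * δ₁ * G.eval 1) / G.eval 1) ≠ 0) :
    Irreducible (compSubst01 p δ₀ δ₁ t G) := by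
  have hp : p.Prime := Fact.out
  have hqN : Nat.card F = p ^ m := by rw [Nat.card_eq_fintype_card, hq]
  have ht : 0 < t := hGt ▸ hG.natDegree_pos
  have hdeg := aux_deg p hp.two_le δ₀ δ₁ t G hGt h1
  set H := compSubst01 p δ₀ δ₁ t G with hH
  set w := ((δ₁ - δ₀) * (derivative G).eval 1 - (t : F) * δ₁ * G.eval 1) / G.eval 1 with hw
  let f := algebraMap F K
  have : CharP K p := charP_of_injective_algebraMap f.injective p
  have hH0 : 0 < H.natDegree := by rw [hdeg]; exact Nat.mul_pos ht hp.pos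
  obtain ⟨b, hb⟩ := IsAlgClosed.exists_aeval_eq_zero K H
    (by exact (natDegree_pos_iff_degree_pos.1 hH0).ne')
  have hδ : f δ₁ - f δ₀ ≠ 0 := by
    rw [sub_ne_zero]; exact fun h => hne (f.injective h).symm
  have hv : b ^ p - b + f δ₁ ≠ 0 := by
    intro hv
    rw [hH, aux_eval0 p δ₀ δ₁ t G b hv] at hb
    rcases mul_eq_zero.1 hb with h | h
    · rw [map_eq_zero, ← hGt] at h
      exact hG.ne_zero (leadingCoeff_eq_zero.1 h)
    · have h := eq_zero_of_pow_eq_zero h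
      apply hδ
      linear_combination hv - h
  set a : K := (b ^ p - b + f δ₀) / (b ^ p - b + f δ₁) with ha
  have haG : aeval a G = 0 := by
    rw [hH, aux_eval p δ₀ δ₁ t G hGt b hv] at hb
    exact (mul_eq_zero.1 hb).resolve_left (pow_ne_zero _ hv)
  have h1a : 1 - a = (f δ₁ - f δ₀) / (b ^ p - b + f δ₁) := by
    rw [ha]; field_simp; ring
  have hc : b ^ p - b = (f δ₁ - f δ₀) * (1 / (1 - a)) - f δ₁ := by
    rw [h1a]; field_simp; ring
  have hcs : ∀ s, (b ^ p - b) ^ (p ^ m) ^ s =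
      (f δ₁ - f δ₀) * (1 / (1 - a ^ (p ^ m) ^ s)) - f δ₁ := by
    intro s
    have e1 := aux_frob (K := K) (1 - X : F[X]) a s
    have e2 := aux_frob (K := K) (C (δ₁ - δ₀) * X - C δ₁ : F[X]) (1 / (1 - a)) s
    rw [hqN] at e1 e2
    simp only [map_sub, map_one, aeval_X, map_mul, aeval_C] at e1 e2
    rw [hc, ← e2, e1, div_pow, one_pow]
  have hsum : ∑ s ∈ Finset.range t, (b ^ p - b) ^ (p ^ m) ^ s = f w := by
    have := aux_sum G hG a haG h1
    rw [hqN, hGt] at this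
    simp_rw [hcs]
    rw [Finset.sum_sub_distrib, ← Finset.mul_sum, this, hw]
    simp only [f, map_sub, map_mul, map_div₀, Finset.sum_const, Finset.card_range, nsmul_eq_mul,
      map_natCast]
    have : algebraMap F K (G.eval 1) ≠ 0 := by simpa using h1
    field_simp
  have hτ : b ^ (p ^ m) ^ t = b + f (TrQP p m w) := by
    have e1 := aux_tele p m b t
    have e2 := aux_tele p 1 b m
    simp only [pow_one] at e2
    rw [e2] at e1
    rw [← sub_eq_iff_eq_add', e1, TrQP, map_sum]
    simp_rw [map_pow, ← hsum, ← pow_mul p m, sum_pow_char_pow]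
    rw [Finset.sum_comm]
    simp_rw [← pow_mul, mul_comm]
  have hτe : ∀ e : ℕ, b ^ (p ^ m) ^ (t * e) = b + e * f (TrQP p m w) := by
    intro e
    induction e with
    | zero => simp
    | succ e ih =>
      have e1 := aux_frob (K := K) (X + C (e * TrQP p m w) : F[X]) b t
      rw [hqN] at e1
      simp only [map_add, map_mul, aeval_X, aeval_C, map_natCast] at e1
      rw [Nat.mul_succ, pow_add (p ^ m), pow_mul b, ih, ← e1, hτ]
      push_cast
      ring
  have hint : IsIntegral F b := Algebra.IsIntegral.isIntegral b
  have hmin := minpoly.irreducible hint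
  have hbd := (aux_dvd (minpoly F b) hmin b (minpoly.aeval F b) _).2 dvd_rfl
  set d := (minpoly F b).natDegree with hd
  have had : a ^ Nat.card F ^ d = a := by
    have e0 := aux_frob (K := K) (X ^ p - X + C δ₀ : F[X]) b d
    have e1 := aux_frob (K := K) (X ^ p - X + C δ₁ : F[X]) b d
    rw [hbd] at e0 e1
    simp only [map_add, map_sub, map_pow, aeval_X, aeval_C] at e0 e1
    rw [ha, div_pow, ← e0, ← e1]
  obtain ⟨e, he⟩ := (aux_dvd G hG a haG d).1 had
  rw [hGt] at he
  have hpe : p ∣ e := by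
    have := hτe e
    rw [← he, ← hqN, hbd] at this
    have h2 : (e : K) * f (TrQP p m w) = 0 := by linear_combination -this
    rcases mul_eq_zero.1 h2 with h | h
    · exact (CharP.cast_eq_zero_iff K p e).1 h
    · exact absurd ((map_eq_zero f).1 h) htr
  have hd0 : 0 < d := hmin.natDegree_pos
  have hle : H.natDegree ≤ d := by
    rw [hdeg]
    exact Nat.le_of_dvd hd0 (he ▸ Nat.mul_dvd_mul_left t hpe)
  obtain ⟨R, hR⟩ := minpoly.dvd F b hb
  have hHne : H ≠ 0 := by rintro h; rw [h] at hH0; simp at hH0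
  have hR0 : R ≠ 0 := by rintro rfl; exact hHne (by rw [hR, mul_zero])
  have hRd : R.natDegree = 0 := by
    have := congrArg natDegree hR
    rw [natDegree_mul hmin.ne_zero hR0] at this
    omega
  have hRu : IsUnit R := isUnit_iff_degree_eq_zero.2 (by rw [degree_eq_natDegree hR0, hRd]; rfl)
  rw [hR]
  exact (irreducible_mul_isUnit hRu).2 hmin

theorem aux_Tr {F : Type*} [Field F] (p m : ℕ) (c x : F) (hc : c ^ p = c) :
    TrQP p m (c * x) = c * TrQP p m x := by
  have : ∀ i, c ^ p ^ i = c := by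
    intro i
    induction i with
    | zero => simp
    | succ i ih => rw [pow_succ, pow_mul, ih, hc]
  simp [TrQP, mul_pow, this, Finset.mul_sum]

theorem aux_ne {F : Type*} [Field F] (G : F[X]) (hG : Irreducible G) (h : 2 ≤ G.natDegree) (x : F) :
    G.eval x ≠ 0 := by
  intro hx
  have := natDegree_eq_of_degree_eq_some (degree_eq_one_of_irreducible_of_root hG hx)
  rw [this] at h
  exact absurd h (by decide)

/-- Proposition 2.4: with `q = p^m`, `δ₀, δ₁` nonzero distinct elements
of the prime field `F_p` (encoded by `δ^p = δ`), `x^p - x + δ₀` and `x^p - x + δ₁`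
coprime, and `P` irreducible of degree `n ≥ 2` over `F_q`, if
`Tr_{q|p}(((δ₁-δ₀)F₀'(1) - nδ₁F₀(1))/F₀(1)) · Tr_{q|p}(((δ₁-δ₀)F₀'(δ₀/δ₁) + nδ₁F₀(δ₀/δ₁))/F₀(δ₀/δ₁)) ≠ 0`
then every `F_k` is irreducible of degree `n·p^k` over `F_q`. -/
theorem FseqProp24_irreducible
    {F : Type*} [Field F] [Fintype F] (p m n : ℕ) (hp : p.Prime) (hm : 0 < m)
    (hq : Fintype.card F = p ^ m)
    (δ₀ δ₁ : F) (hδ₀ : δ₀ ≠ 0) (hδ₁ : δ₁ ≠ 0) (hδ₀p : δ₀ ^ p = δ₀) (hδ₁p : δ₁ ^ p = δ₁)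
    (hne : δ₀ ≠ δ₁)
    (hcop : IsCoprime ((X : Polynomial F) ^ p - X + C δ₀) ((X : Polynomial F) ^ p - X + C δ₁))
    (P : Polynomial F) (hPirr : Irreducible P) (hPdeg : P.natDegree = n) (hn : 2 ≤ n)
    (htr : TrQP p m (((δ₁ - δ₀) * (Polynomial.derivative P).eval 1 -
          (n : F) * δ₁ * P.eval 1) / P.eval 1) *
        TrQP p m (((δ₁ - δ₀) * (Polynomial.derivative P).eval (δ₀ / δ₁) +
          (n : F) * δ₁ * P.eval (δ₀ / δ₁)) / P.eval (δ₀ / δ₁)) ≠ 0) :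
    ∀ k : ℕ, Irreducible (FseqProp24 p δ₀ δ₁ n P k) ∧
      (FseqProp24 p δ₀ δ₁ n P k).natDegree = n * p ^ k := by
  have hpF : Fact p.Prime := ⟨hp⟩
  have hchar : CharP F p := by
    obtain ⟨r, hr⟩ := CharP.exists F
    have hrp : r.Prime := CharP.char_is_prime F r
    have h0 : ((Fintype.card F : ℕ) : F) = 0 := FiniteField.cast_card_eq_zero F
    rw [hq, CharP.cast_eq_zero_iff F r] at h0
    have := (Nat.prime_dvd_prime_iff_eq hrp hp).1 (hrp.dvd_of_dvd_pow h0)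
    rwa [← this]
  set ρ := δ₀ / δ₁ with hρ
  have hρp : ρ ^ p = ρ := by rw [hρ, div_pow, hδ₀p, hδ₁p]
  have main : ∀ k : ℕ, Irreducible (FseqProp24 p δ₀ δ₁ n P k) ∧
      (FseqProp24 p δ₀ δ₁ n P k).natDegree = n * p ^ k ∧
      TrQP p m (((δ₁ - δ₀) * (derivative (FseqProp24 p δ₀ δ₁ n P k)).eval 1 -
        ((n * p ^ k : ℕ) : F) * δ₁ * (FseqProp24 p δ₀ δ₁ n P k).eval 1) /
          (FseqProp24 p δ₀ δ₁ n P k).eval 1) ≠ 0 ∧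
      TrQP p m (((δ₁ - δ₀) * (derivative (FseqProp24 p δ₀ δ₁ n P k)).eval ρ +
        ((n * p ^ k : ℕ) : F) * δ₁ * (FseqProp24 p δ₀ δ₁ n P k).eval ρ) /
          (FseqProp24 p δ₀ δ₁ n P k).eval ρ) ≠ 0 := by
    intro k
    induction k with
    | zero =>
      rw [pow_zero, mul_one]
      exact ⟨hPirr, hPdeg, left_ne_zero_of_mul htr, right_ne_zero_of_mul htr⟩
    | succ k ih =>
      obtain ⟨hirr, hdeg, ht1, ht2⟩ := ih
      rw [FseqProp24]
      set G := FseqProp24 p δ₀ δ₁ n P k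
      have hge : ∀ j, 2 ≤ n * p ^ j := fun j =>
        hn.trans (Nat.le_mul_of_pos_right n (pow_pos hp.pos j))
      have hG := aux_ne G hirr (hdeg ▸ hge k)
      have hd := aux_deg p hp.two_le δ₀ δ₁ _ G hdeg (hG 1)
      have hI := aux_step (AlgebraicClosure F) p m _ hq δ₀ δ₁ hne G hirr hdeg (hG 1) ht1
      have hD := fun x hx => aux_deriv p δ₀ δ₁ hδ₁ _ G hdeg x hx
      have hE : ∀ x : F, x ^ p = x → (compSubst01 p δ₀ δ₁ (n * p ^ k) G).eval x =
          δ₁ ^ (n * p ^ k) * G.eval ρ := by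
        intro x hx
        have := aux_eval (K := F) p δ₀ δ₁ _ G hdeg x (by simpa [hx] using hδ₁)
        simpa [hx, coe_aeval_eq_eval] using this
      have h0 : ((n * p ^ (k + 1) : ℕ) : F) = 0 := by
        rw [CharP.cast_eq_zero_iff F p]
        exact Dvd.dvd.mul_left (dvd_pow_self p (by omega)) n
      have hq' : ∀ x : F, x ^ p = x →
          ((δ₁ - δ₀) * (derivative (compSubst01 p δ₀ δ₁ (n * p ^ k) G)).eval x) /
            (compSubst01 p δ₀ δ₁ (n * p ^ k) G).eval x =
          (-(δ₁ - δ₀) / δ₁ ^ 2) * (((δ₁ - δ₀) * (derivative G).eval ρ +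
            ((n * p ^ k : ℕ) : F) * δ₁ * G.eval ρ) / G.eval ρ) := by
        intro x hx
        have h2 := hG ρ
        have h3 := hD x hx
        have h4 : δ₁ ^ (n * p ^ k) ≠ 0 := pow_ne_zero _ hδ₁
        rw [hE x hx, div_mul_div_comm, div_eq_div_iff (by positivity) (by positivity)]
        rw [← hρ] at h3
        linear_combination (δ₁ - δ₀) * G.eval ρ * h3
      have hcp : (-(δ₁ - δ₀) / δ₁ ^ 2) ^ p = -(δ₁ - δ₀) / δ₁ ^ 2 := by
        rw [div_pow, neg_sub, sub_pow_char, hδ₀p, hδ₁p, ← pow_mul, mul_comm, pow_mul, hδ₁p]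
      have hc0 : -(δ₁ - δ₀) / δ₁ ^ 2 ≠ 0 :=
        div_ne_zero (by rw [neg_sub]; exact sub_ne_zero.2 hne) (pow_ne_zero _ hδ₁)
      refine ⟨hI, by rw [hd, pow_succ, mul_assoc], ?_, ?_⟩
      · rw [h0, zero_mul, zero_mul, sub_zero, hq' 1 (one_pow p), aux_Tr _ _ _ _ hcp]
        exact mul_ne_zero hc0 ht2
      · rw [h0, zero_mul, zero_mul, add_zero, hq' ρ hρp, aux_Tr _ _ _ _ hcp]
        exact mul_ne_zero hc0 ht2
  exact fun k => ⟨(main k).1, (main k).2.1⟩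
end

section
/- Let q = p^m with p prime, and let n = r·p^e where e ≥ 1 and r either equals 1 or is a prime different from p such that q is a primitive root modulo r. Let P(x) be a k-normal polynomial of degree n over F_q and let δ be a nonzero element of the prime field F_p ⊆ F_q. Define F₀(x) = P*(x) and, for u ≥ 1, F_u(x) = (x^p − x + δ)^{n·p^{u−1}} · F_{u−1}((x^p − x)/(x^p − x + δ)). If k < p^e and Tr_{q|p}( (P*)′(0)/P*(0) ) · Tr_{q|p}( (P*)′(1)/P*(1) ) ≠ 0, then for every u ≥ 0 the reciprocal polynomial F_u*(x) is a k-normal polynomial of degree n·p^u over F_q. -/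
open Polynomial

/-- The polynomial `∑_{i=0}^{n-1} α^{q^i} X^{n-1-i}` attached to `α`. -/
noncomputable def kNormalTestPoly {E : Type*} [Field E] (q n : ℕ) (α : E) : Polynomial E :=
  ∑ i ∈ Finset.range n, Polynomial.C (α ^ q ^ i) * Polynomial.X ^ (n - 1 - i)

/-- `α ∈ F_{q^n}` is `k`-normal over `F_q` if
`deg(gcd(X^n - 1, ∑_{i=0}^{n-1} α^{q^i} X^{n-1-i})) = k`. -/
def IsKNormalElem {E : Type*} [Field E] (q n k : ℕ) (α : E) : Prop :=
  letI : DecidableEq (Polynomial E) := Classical.decEq _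
  (EuclideanDomain.gcd ((Polynomial.X : Polynomial E) ^ n - 1) (kNormalTestPoly q n α)).natDegree = k

/-- `P` is a `k`-normal (`N_k`-) polynomial of degree `n` over `F_q`: an irreducible
polynomial of degree `n` all of whose roots (in a splitting field, which realizes
`F_{q^n}`) are `k`-normal elements over `F_q`. -/
def IsNkPolynomial {F : Type*} [Field F] [Fintype F] (k n : ℕ) (P : Polynomial F) : Prop :=
  Irreducible P ∧ P.natDegree = n ∧
    ∀ β ∈ P.aroots P.SplittingField, IsKNormalElem (Fintype.card F) n k β

/-- `(x^p - x + δ)^t · G((x^p - x)/(x^p - x + δ))` for `G` of degree `t`, i.e.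
`∑_{i=0}^t g_i (x^p - x)^i (x^p - x + δ)^{t-i}` where `G = ∑ g_i x^i`. -/
noncomputable def compSubstAS {F : Type*} [Field F] (p : ℕ) (δ : F) (t : ℕ)
    (G : Polynomial F) : Polynomial F :=
  ∑ i ∈ Finset.range (t + 1), Polynomial.C (G.coeff i) *
    (X ^ p - X) ^ i * (X ^ p - X + C δ) ^ (t - i)

/-- The sequence `F₀ = P*`, `F_u = (x^p-x+δ)^{n·p^{u-1}} F_{u-1}((x^p-x)/(x^p-x+δ))`. -/
noncomputable def FseqAS {F : Type*} [Field F] (p : ℕ) (δ : F) (n : ℕ)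
    (P0 : Polynomial F) : ℕ → Polynomial F
  | 0 => P0
  | u + 1 => compSubstAS p δ (n * p ^ u) (FseqAS p δ n P0 u)

section helpers
variable {F K : Type*} [Field F] [Fintype F] [Field K] [Algebra F K]

theorem h_frob (i : ℕ) (x : K) :
    (FiniteField.frobeniusAlgHom F K ^ i) x = x ^ (Fintype.card F) ^ i := by
  simp [AlgHom.coe_pow, FiniteField.coe_frobeniusAlgHom, pow_iterate]

theorem h_B {G : F[X]} (hG : Irreducible G) {x : K} (hx : aeval x G = 0) (i : ℕ) :
    x ^ (Fintype.card F) ^ i = x ↔ G.natDegree ∣ i := by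
  rw [hG.natDegree_dvd_iff_dvd_X_pow_card_pow_sub_X, ← hG.dvd_iff_aeval_eq_zero hx]
  simp [sub_eq_zero]

theorem h_A {G : F[X]} (hG : G ≠ 0) {x : K} (hx : aeval x G = 0)
    (h : ∀ i, x ^ (Fintype.card F) ^ i = x → G.natDegree ∣ i) : Irreducible G := by
  have hint : IsIntegral F x := isAlgebraic_iff_isIntegral.mp ⟨G, hG, hx⟩
  have hm := minpoly.irreducible hint
  have h1 := h _ ((h_B hm (minpoly.aeval F x) _).2 dvd_rfl)
  have h2 : minpoly F x ∣ G := minpoly.dvd F x hx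
  have h3 : G.natDegree ≤ (minpoly F x).natDegree := Nat.le_of_dvd (minpoly.natDegree_pos hint) h1
  have := (Polynomial.associated_of_dvd_of_natDegree_le h2 hG h3)
  exact this.irreducible hm

theorem h_C0 {h : K[X]} {N : ℕ} (h0 : h ≠ 0) (hN : h.natDegree = N) (f : ℕ → K)
    (hf : ∀ i < N, h.eval (f i) = 0) (hinj : ∀ i < N, ∀ j < N, f i = f j → i = j) (a : K)
    (ha : h.eval a ≠ 0) :
    h.derivative.eval a / h.eval a = ∑ i ∈ Finset.range N, 1 / (a - f i) := by
  classical
  have hinj' : Set.InjOn f (Finset.range N) := by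
    intro i hi j hj hij
    exact hinj i (by simpa using hi) j (by simpa using hj) hij
  have hle : (Multiset.map f (Finset.range N).val) ≤ h.roots := by
    rw [← Finset.image_val_of_injOn hinj']
    rw [Multiset.le_iff_subset (Finset.nodup _)]
    intro y hy
    simp only [Finset.mem_val, Finset.mem_image, Finset.mem_range] at hy
    obtain ⟨i, hi, rfl⟩ := hy
    exact (mem_roots h0).2 (hf i hi)
  have heq : (Multiset.map f (Finset.range N).val) = h.roots := by
    apply Multiset.eq_of_le_of_card_le hle
    simpa [hN] using h.card_roots'
  have hs : h.Splits := by
    rw [splits_iff_card_roots, ← heq]; simp [hN]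
  rw [hs.eval_derivative_div_eval_of_ne_zero ha, ← heq, Multiset.map_map]
  rfl

theorem h_C {G : F[X]} (hG : Irreducible G) {x : K} (hx : aeval x G = 0) (a : F)
    (ha : G.eval a ≠ 0) :
    ∑ i ∈ Finset.range G.natDegree, 1 / (algebraMap F K a - x ^ (Fintype.card F) ^ i) =
      algebraMap F K (G.derivative.eval a / G.eval a) := by
  have key := h_C0 (h := G.map (algebraMap F K)) (N := G.natDegree)
    (by simpa using hG.ne_zero) (by simp) (fun i => x ^ (Fintype.card F) ^ i) ?_ ?_
    (algebraMap F K a) (by simpa using ha)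
  · rw [← key, derivative_map]
    simp only [eval_map_algebraMap, aeval_algebraMap_apply_eq_algebraMap_eval, map_div₀]
  · intro i _
    have := aeval_algHom_apply (FiniteField.frobeniusAlgHom F K ^ i) x G
    rw [hx, map_zero, h_frob] at this
    rw [eval_map_algebraMap, this]
  · have main : ∀ i j, i ≤ j → j < G.natDegree →
        x ^ (Fintype.card F) ^ i = x ^ (Fintype.card F) ^ j → i = j := by
      intro i j hij hj h
      obtain ⟨d, rfl⟩ := Nat.exists_eq_add_of_le hij
      rw [pow_add, mul_comm, pow_mul, ← h_frob i x, ← h_frob i (x ^ _)] at h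
      have h2 := ((h_B hG hx d).1 ((FiniteField.frobeniusAlgHom F K ^ i).injective h).symm)
      have : d = 0 := Nat.eq_zero_of_dvd_of_lt h2 (by omega)
      omega
    intro i hi j hj h
    rcases le_total i j with h' | h'
    · exact main i j h' hj h
    · exact (main j i h' hi h.symm).symm
end helpers
section gcds
variable {K : Type*} [Field K]

theorem h_sum {A : Type*} [AddCommMonoid A] (t p : ℕ) (f : ℕ → A) :
    ∑ i ∈ Finset.range (t * p), f i =
      ∑ i ∈ Finset.range t, ∑ l ∈ Finset.range p, f (i + t * l) := by
  rw [Finset.sum_comm]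
  induction p with
  | zero => simp
  | succ p ih =>
    rw [Finset.sum_range_succ, ← ih, mul_add, mul_one, Finset.sum_range_add]
    simp [add_comm]

theorem h_gcd0 [DecidableEq K[X]] {A B A' B' : K[X]}
    (h : ∀ d, (d ∣ A ∧ d ∣ B) ↔ (d ∣ A' ∧ d ∣ B')) :
    (EuclideanDomain.gcd A B).natDegree = (EuclideanDomain.gcd A' B').natDegree := by
  have h1 : EuclideanDomain.gcd A B ∣ EuclideanDomain.gcd A' B' := by
    have := (h _).1 ⟨EuclideanDomain.gcd_dvd_left A B, EuclideanDomain.gcd_dvd_right A B⟩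
    exact EuclideanDomain.dvd_gcd this.1 this.2
  have h2 : EuclideanDomain.gcd A' B' ∣ EuclideanDomain.gcd A B := by
    have := (h _).2 ⟨EuclideanDomain.gcd_dvd_left A' B', EuclideanDomain.gcd_dvd_right A' B'⟩
    exact EuclideanDomain.dvd_gcd this.1 this.2
  exact natDegree_eq_of_degree_eq (degree_eq_degree_of_associated (associated_of_dvd_dvd h1 h2))

theorem h_gcd1 [DecidableEq K[X]] {M a b : K[X]} (h : M ∣ a - b) :
    (EuclideanDomain.gcd M a).natDegree = (EuclideanDomain.gcd M b).natDegree := by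
  apply h_gcd0
  intro d
  refine and_congr_right fun hd => ?_
  exact (dvd_iff_dvd_of_dvd_sub (hd.trans h))

theorem h_gcd2 [DecidableEq K[X]] {M h g : K[X]} {P p : ℕ} (hp : p ≠ 0) (hM0 : M ≠ 0)
    (hM : M = h ^ P)
    (hdeg : (EuclideanDomain.gcd M g).natDegree < P) :
    (EuclideanDomain.gcd (M ^ p) g).natDegree = (EuclideanDomain.gcd M g).natDegree := by
  apply h_gcd0
  intro d
  constructor
  · rintro ⟨h1, h2⟩
    refine ⟨?_, h2⟩
    have hd0 : d ≠ 0 := by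
      rintro rfl
      exact hM0 (pow_eq_zero_iff hp |>.1 (zero_dvd_iff.1 h1))
    rw [UniqueFactorizationMonoid.dvd_iff_emultiplicity_le hd0]
    intro π hπ
    apply emultiplicity_le_emultiplicity_iff.2
    intro j hj
    rcases Nat.eq_zero_or_pos j with rfl | hj0
    · simp
    have hπM : π ∣ M := hπ.dvd_of_dvd_pow ((dvd_pow_self π hj0.ne').trans (hj.trans h1))
    have hπP : π ^ P ∣ M := by
      rw [hM] at hπM ⊢
      exact pow_dvd_pow_of_dvd (hπ.dvd_of_dvd_pow hπM) P
    by_cases hjP : j ≤ P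
    · exact (pow_dvd_pow π hjP).trans hπP
    · exfalso
      have h3 : π ^ P ∣ EuclideanDomain.gcd M g :=
        EuclideanDomain.dvd_gcd hπP ((pow_dvd_pow π (by omega)).trans (hj.trans h2))
      have h4 : EuclideanDomain.gcd M g ≠ 0 := by
        intro h0
        exact hM0 (EuclideanDomain.gcd_eq_zero_iff.1 h0).1
      have h5 := natDegree_le_of_dvd h3 h4
      rw [natDegree_pow] at h5
      have h6 := hπ.irreducible.natDegree_pos
      nlinarith
  · rintro ⟨h1, h2⟩
    exact ⟨h1.trans (dvd_pow_self M hp), h2⟩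

theorem h_gcd3 [DecidableEq K[X]] {M Ψ w : K[X]} {c : K} (hc : c ≠ 0) (hM : M = (X - C 1) * Ψ)
    (hw : w.eval 1 ≠ 0) (hΨ : Ψ.eval 1 = 0) :
    (EuclideanDomain.gcd M (C c * (Ψ - w))).natDegree = (EuclideanDomain.gcd M w).natDegree := by
  have key : ∀ d v : K[X], v.eval 1 ≠ 0 → d ∣ M → d ∣ v → d ∣ Ψ := by
    intro d v hv h1 h2
    rw [hM] at h1
    refine IsCoprime.dvd_of_dvd_mul_left ?_ h1
    apply IsCoprime.symm
    rw [(irreducible_X_sub_C (1:K)).coprime_iff_not_dvd]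
    intro h3
    exact hv (dvd_iff_isRoot.1 (h3.trans h2))
  have hu : IsUnit (C c) := isUnit_C.2 hc.isUnit
  apply h_gcd0
  intro d
  refine and_congr_right fun hd => ?_
  rw [hu.dvd_mul_left]
  constructor
  · intro h
    have := key d _ (by simpa [hΨ] using hw) hd h
    exact (dvd_sub_right this).1 h
  · intro h
    exact dvd_sub (key d _ hw hd h) h

theorem h_test (q t p : ℕ) (α β : K)
    (hβ : ∀ i, ∑ l ∈ Finset.range p, α ^ q ^ (i + t * l) = β ^ q ^ i) :
    (X ^ t - 1 : K[X]) ∣ kNormalTestPoly q (t * p) α - kNormalTestPoly q t β := by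
  unfold kNormalTestPoly
  rw [h_sum, ← Finset.sum_sub_distrib]
  apply Finset.dvd_sum
  intro i hi
  rw [← hβ, map_sum, Finset.sum_mul, ← Finset.sum_sub_distrib]
  apply Finset.dvd_sum
  intro l hl
  rw [Finset.mem_range] at hi hl
  have : t * p - 1 - (i + t * l) = t * (p - 1 - l) + (t - 1 - i) := by
    obtain ⟨a, rfl⟩ := Nat.exists_eq_add_of_lt hi
    obtain ⟨b, rfl⟩ := Nat.exists_eq_add_of_lt hl
    have e1 : l + b + 1 - 1 - l = b := by omega
    have e2 : i + a + 1 - 1 - i = a := by omega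
    rw [e1, e2]
    have : (i + a + 1) * (l + b + 1) = (i + a + 1) * l + (i + a + 1) * b + (i + a + 1) := by ring
    rw [this]; omega
  rw [this, ← mul_sub]
  apply Dvd.dvd.mul_left
  rw [pow_add, pow_mul, ← sub_one_mul]
  exact Dvd.dvd.mul_right (sub_one_dvd_pow_sub_one _ _) _

end gcds
section comps
variable {F K : Type*} [Field F] [Field K] [Algebra F K]

theorem h_reflect {G : F[X]} {N : ℕ} (hN : G.natDegree ≤ N) {x : K} (hx : x ≠ 0) :
    aeval x⁻¹ (reflect N G) = 0 ↔ aeval x G = 0 := by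
  let _ : Invertible x := invertibleOfNonzero hx
  have := eval₂_reflect_eq_zero_iff (algebraMap F K) x N G hN
  rwa [invOf_eq_inv] at this

theorem h_comp_aeval (p : ℕ) (δ : F) (t : ℕ) (G : F[X]) (hG : G.natDegree ≤ t) (x : K)
    (hz : x ^ p - x + algebraMap F K δ ≠ 0) :
    aeval x (compSubstAS p δ t G) = (x ^ p - x + algebraMap F K δ) ^ t *
      aeval ((x ^ p - x) / (x ^ p - x + algebraMap F K δ)) G := by
  unfold compSubstAS
  rw [aeval_eq_sum_range' (Nat.lt_succ_of_le hG), Finset.mul_sum, map_sum]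
  apply Finset.sum_congr rfl
  intro i hi
  have hi' : i ≤ t := by simpa [Nat.lt_succ_iff] using hi
  obtain ⟨d, rfl⟩ := Nat.exists_eq_add_of_le hi'
  have : i + d - i = d := by omega
  simp only [map_mul, map_pow, map_sub, map_add, aeval_C, aeval_X, Algebra.smul_def, this, div_pow]
  rw [pow_add]
  field_simp

theorem h_comp_root {p : ℕ} {δ : F} {t : ℕ} {G : F[X]} (hG : G.natDegree = t)
    (h0 : G.coeff 0 ≠ 0) (hδ : δ ≠ 0) {x : K} (hx : aeval x (compSubstAS p δ t G) = 0) :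
    x ^ p - x ≠ 0 ∧ x ^ p - x + algebraMap F K δ ≠ 0 ∧
      aeval ((x ^ p - x) / (x ^ p - x + algebraMap F K δ)) G = 0 := by
  have hδ' : algebraMap F K δ ≠ 0 := by simpa using hδ
  have hz : x ^ p - x + algebraMap F K δ ≠ 0 := by
    intro hz
    have hy : x ^ p - x = - algebraMap F K δ := eq_neg_of_add_eq_zero_left hz
    unfold compSubstAS at hx
    simp only [map_sum, map_mul, map_pow, map_sub, map_add, aeval_C, aeval_X, hz] at hx
    rw [Finset.sum_eq_single t] at hx
    · rw [hy] at hx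
      have : G.coeff t ≠ 0 := by
        rw [← hG]
        have : G ≠ 0 := by rintro rfl; simp at h0
        simpa using this
      simp [this, hδ] at hx
    · intro b hb hbt
      have : t - b ≠ 0 := by have := Finset.mem_range.1 hb; omega
      simp [this]
    · simp
  rw [h_comp_aeval p δ t G hG.le x hz] at hx
  have h := (mul_eq_zero.1 hx).resolve_left (pow_ne_zero _ hz)
  refine ⟨?_, hz, h⟩
  intro hy
  rw [hy, zero_div, ← coeff_zero_eq_aeval_zero'] at h
  simp [h0] at h

theorem h_comp_deg {p : ℕ} (hp : 2 ≤ p) (δ : F) (t : ℕ) {G : F[X]} (hG : G.natDegree ≤ t)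
    (h1 : G.eval 1 ≠ 0) : (compSubstAS p δ t G).natDegree = t * p := by
  have m1 : (X ^ p - X : F[X]).Monic := by
    apply monic_X_pow_sub
    rw [degree_X]; exact_mod_cast hp
  have d1 : (X ^ p - X : F[X]).natDegree = p := by
    rw [natDegree_sub_eq_left_of_natDegree_lt] <;> simp; omega
  have m2 : (X ^ p - X + C δ : F[X]).Monic := by
    apply m1.add_of_left
    refine lt_of_le_of_lt degree_C_le ?_
    rw [degree_eq_natDegree m1.ne_zero, d1]; exact_mod_cast (by omega)
  have d2 : (X ^ p - X + C δ : F[X]).natDegree = p := by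
    rw [natDegree_add_C, d1]
  have m3 : ∀ i ≤ t, ((X ^ p - X) ^ i * (X ^ p - X + C δ) ^ (t - i) : F[X]).Monic := fun i _ =>
    (m1.pow i).mul (m2.pow _)
  have d3 : ∀ i ≤ t, ((X ^ p - X) ^ i * (X ^ p - X + C δ) ^ (t - i) : F[X]).natDegree = t * p := by
    intro i hi
    rw [(m1.pow i).natDegree_mul (m2.pow _), m1.natDegree_pow, m2.natDegree_pow, d1, d2,
      ← add_mul]
    congr 1; omega
  unfold compSubstAS
  apply natDegree_eq_of_le_of_coeff_ne_zero
  · apply natDegree_sum_le_of_forall_le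
    intro i hi
    have hi' : i ≤ t := by simpa [Nat.lt_succ_iff] using hi
    rw [mul_assoc]
    exact (natDegree_C_mul_le _ _).trans (d3 i hi').le
  · rw [finsetSum_coeff]
    have : ∀ i ∈ Finset.range (t + 1), (C (G.coeff i) * (X ^ p - X) ^ i *
        (X ^ p - X + C δ) ^ (t - i)).coeff (t * p) = G.coeff i * 1 ^ i := by
      intro i hi
      have hi' : i ≤ t := by simpa [Nat.lt_succ_iff] using hi
      rw [mul_assoc, coeff_C_mul, ← d3 i hi']
      rw [(m3 i hi').coeff_natDegree, one_pow]
    rw [Finset.sum_congr rfl this, ← eval_eq_sum_range' (Nat.lt_succ_of_le hG)]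
    exact h1

theorem h_comp_ratio {p : ℕ} [CharP F p] {δ : F} (hδ : δ ≠ 0) {t : ℕ} (ht : 0 < t)
    (htp : (t : F) = 0) {G : F[X]} (a : F) (ha : a ^ p = a) :
    (compSubstAS p δ t G).derivative.eval a / (compSubstAS p δ t G).eval a =
      - δ⁻¹ * (G.derivative.eval 0 / G.eval 0) := by
  have e1 : (compSubstAS p δ t G).eval a = G.coeff 0 * δ ^ t := by
    unfold compSubstAS
    rw [eval_finsetSum, Finset.sum_eq_single 0]
    · simp [ha]
    · intro b _ hb
      simp [ha, hb]
    · simp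
  have e2 : (compSubstAS p δ t G).derivative.eval a = - (G.coeff 1 * δ ^ (t - 1)) := by
    unfold compSubstAS
    rw [derivative_sum, eval_finsetSum, Finset.sum_eq_single 1]
    · simp [derivative_mul, derivative_pow, ha]
    · intro b hb hb1
      rcases Nat.eq_zero_or_pos b with rfl | hb0
      · simp [derivative_pow, htp]
      · have h2 : b - 1 ≠ 0 := by omega
        simp [derivative_mul, derivative_pow, ha, h2, hb0.ne']
    · intro h; simp at h; omega
  have e3 : G.eval 0 = G.coeff 0 := (coeff_zero_eq_eval_zero G).symm
  have e4 : G.derivative.eval 0 = G.coeff 1 := by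
    rw [← coeff_zero_eq_eval_zero, coeff_derivative]; simp
  rw [e1, e2, e3, e4]
  obtain ⟨s, rfl⟩ := Nat.exists_eq_add_of_lt ht
  simp only [zero_add, Nat.add_sub_cancel, pow_succ]
  field_simp

theorem h_map {E E' : Type*} [Field E] [Field E'] (f : E →+* E') (q n k : ℕ) (α : E) :
    IsKNormalElem q n k (f α) ↔ IsKNormalElem q n k α := by
  classical
  unfold IsKNormalElem
  have h1 : ((X : E'[X]) ^ n - 1) = ((X : E[X]) ^ n - 1).map f := by simp
  have h2 : kNormalTestPoly q n (f α) = (kNormalTestPoly q n α).map f := by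
    simp [kNormalTestPoly, Polynomial.map_sum]
  simp only [h1, h2]
  have h3 := congrArg natDegree (gcd_map (p := (X : E[X]) ^ n - 1) (q := kNormalTestPoly q n α) f)
  rw [natDegree_map] at h3
  constructor
  · intro h
    rw [← h]
    convert! h3.symm
  · intro h
    rw [← h]
    convert! h3

theorem h_all [Fintype F] {k n : ℕ} {P : F[X]} (hP : IsNkPolynomial k n P) {x : K}
    (hx : aeval x P = 0) : IsKNormalElem (Fintype.card F) n k x := by
  obtain ⟨hi, hd, hk⟩ := hP
  have : Fact (Irreducible P) := ⟨hi⟩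
  have hs : (P.map (algebraMap F P.SplittingField)).Splits := SplittingField.splits P
  obtain ⟨b, hb⟩ := hs.exists_eval_eq_zero (by rw [degree_map]; exact (natDegree_pos_iff_degree_pos.1 hi.natDegree_pos).ne')
  have hb' : aeval b P = 0 := by rwa [eval_map_algebraMap] at hb
  have h1 := hk b ((mem_aroots).2 ⟨hi.ne_zero, hb'⟩)
  have l1 : AdjoinRoot.lift (algebraMap F _) b hb' (AdjoinRoot.root P) = b := AdjoinRoot.lift_root _
  have l2 : AdjoinRoot.lift (algebraMap F _) x hx (AdjoinRoot.root P) = x := AdjoinRoot.lift_root _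
  rw [← l1, h_map] at h1
  rw [← l2, h_map]
  exact h1

end comps
section steps
variable {F K : Type*} [Field F] [Fintype F] [Field K] [Algebra F K]

theorem h_tr_pow {p m : ℕ} (hp : p.Prime) [CharP F p] (hq : Fintype.card F = p ^ m) (s : F) :
    (TrQP p m s) ^ p = TrQP p m s := by
  have := Fact.mk hp
  unfold TrQP
  rw [sum_pow_char]
  have h1 : ∀ i ∈ Finset.range m, (s ^ p ^ i) ^ p = s ^ p ^ (i + 1) := by
    intro i _; rw [← pow_mul, pow_succ]
  rw [Finset.sum_congr rfl h1]
  have h2 := Finset.sum_range_succ (fun i => s ^ p ^ i) m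
  rw [Finset.sum_range_succ'] at h2
  have h3 : s ^ p ^ m = s := by rw [← hq, FiniteField.pow_card]
  simp only [pow_zero, pow_one, h3] at h2
  exact add_right_cancel h2

theorem h_tr_mul {p m : ℕ} {δ : F} (hδp : δ ^ p = δ) (s : F) :
    TrQP p m (δ * s) = δ * TrQP p m s := by
  unfold TrQP
  rw [Finset.mul_sum]
  apply Finset.sum_congr rfl
  intro i hi
  rw [mul_pow]
  congr 1
  clear hi
  induction i with
  | zero => simp
  | succ i ih => rw [pow_succ, pow_mul, ih, hδp]

/-- Frobenius shift of an Artin-Schreier root. -/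
theorem h_shift {p m t : ℕ} (hp : p.Prime) [CharP F p] (hq : Fintype.card F = p ^ m)
    {G : F[X]} (hG : Irreducible G) (hGt : G.natDegree = t) (htp : (t : F) = 0)
    (h1 : G.eval 1 ≠ 0) {δ : F} (hδ : δ ≠ 0) (hδp : δ ^ p = δ) {x : K}
    (hz : x ^ p - x + algebraMap F K δ ≠ 0)
    (hγ : aeval ((x ^ p - x) / (x ^ p - x + algebraMap F K δ)) G = 0) :
    x ^ (Fintype.card F) ^ t =
      x + algebraMap F K (δ * TrQP p m (G.derivative.eval 1 / G.eval 1)) := by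
  have := Fact.mk hp
  have : CharP K p := charP_of_injective_algebraMap' F p
  have hδ' : algebraMap F K δ ≠ 0 := by simpa using hδ
  set y := x ^ p - x with hy
  set d := algebraMap F K δ with hd
  set γ := y / (y + d) with hγd
  have hyγ : y = d * (1 / (1 - γ)) - d := by
    have : 1 - γ = d / (y + d) := by rw [hγd]; field_simp; ring
    rw [this]; field_simp; ring
  have tele : x ^ p ^ (m * t) - x = ∑ i ∈ Finset.range (m * t), y ^ p ^ i := by
    have h := Finset.sum_range_sub (fun i => x ^ p ^ i) (m * t)
    rw [pow_zero, pow_one] at h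
    rw [← h]
    apply Finset.sum_congr rfl
    intro i _
    rw [hy, sub_pow_char_pow, ← pow_mul, ← pow_succ']
  have hsum : ∑ a ∈ Finset.range t, y ^ (Fintype.card F) ^ a =
      algebraMap F K (δ * (G.derivative.eval 1 / G.eval 1)) := by
    have hterm : ∀ a ∈ Finset.range t, y ^ (Fintype.card F) ^ a =
        d * (1 / (algebraMap F K 1 - γ ^ (Fintype.card F) ^ a)) - d := by
      intro a _
      rw [← h_frob (F := F) a y, ← h_frob (F := F) a γ]
      conv_lhs => rw [hyγ]
      simp only [hd, map_sub, map_mul, map_div₀, map_one, AlgHom.commutes]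
    rw [Finset.sum_congr rfl hterm, Finset.sum_sub_distrib, ← Finset.mul_sum]
    have := h_C hG hγ 1 h1
    rw [hGt] at this
    rw [this, map_mul]
    have ht0 : (t : K) = 0 := by
      have := congrArg (algebraMap F K) htp
      simpa using this
    simp [ht0, hd]
  have e : x ^ (Fintype.card F) ^ t = x ^ p ^ (m * t) := by rw [hq, pow_mul]
  rw [e, ← h_tr_mul hδp, ← sub_eq_iff_eq_add', tele, h_sum]
  unfold TrQP
  rw [map_sum]
  apply Finset.sum_congr rfl
  intro b _
  rw [map_pow, ← hsum, sum_pow_char_pow]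
  apply Finset.sum_congr rfl
  intro a _
  rw [← pow_mul, hq, ← pow_mul, ← pow_add, add_comm]

theorem h_shift_iter {t : ℕ} {x : K} {j : F}
    (h : x ^ (Fintype.card F) ^ t = x + algebraMap F K j) (l : ℕ) :
    x ^ (Fintype.card F) ^ (t * l) = x + l * algebraMap F K j := by
  induction l with
  | zero => simp
  | succ l ih =>
    rw [mul_add, mul_one, pow_add, pow_mul, ih, ← h_frob (F := F) t]
    rw [map_add, map_mul, h_frob, h, AlgHom.commutes, map_natCast]
    push_cast; ring

theorem h_order {p t : ℕ} (hp : p.Prime) [CharP F p]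
    {G : F[X]} (hG : Irreducible G) (hGt : G.natDegree = t) {δ : F} {x : K} {j : F} (hj : j ≠ 0)
    (hγ : aeval ((x ^ p - x) / (x ^ p - x + algebraMap F K δ)) G = 0)
    (h : x ^ (Fintype.card F) ^ t = x + algebraMap F K j) (i : ℕ)
    (hi : x ^ (Fintype.card F) ^ i = x) : t * p ∣ i := by
  have : CharP K p := charP_of_injective_algebraMap' F p
  have h1 : t ∣ i := by
    rw [← hGt, ← h_B hG hγ, ← h_frob (F := F)]
    rw [← h_frob (F := F)] at hi
    simp only [map_sub, map_add, map_pow, map_div₀, AlgHom.commutes, hi]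
  obtain ⟨l, rfl⟩ := h1
  rw [h_shift_iter h] at hi
  have h2 : (l : K) * algebraMap F K j = 0 := by simpa using hi
  have h3 : (l : K) = 0 := by simpa [hj] using h2
  exact mul_dvd_mul_left t ((CharP.cast_eq_zero_iff K p l).1 h3)

theorem h_trace {p t : ℕ} (hp : p.Prime) [CharP F p] {x : K} {j : F} (hj : j ≠ 0) (hjp : j ^ p = j)
    (hy : x ^ p - x ≠ 0)
    (h : x ^ (Fintype.card F) ^ t = x + algebraMap F K j) :
    ∑ l ∈ Finset.range p, x⁻¹ ^ (Fintype.card F) ^ (t * l) = - (x ^ p - x)⁻¹ := by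
  have := Fact.mk hp
  have : CharP K p := charP_of_injective_algebraMap' F p
  have hjp' : (algebraMap F K j) ^ p = algebraMap F K j := by rw [← map_pow, hjp]
  have hp2 := hp.two_le
  have hdeg : (X ^ p - X - C (x ^ p - x) : K[X]).natDegree = p := by
    rw [natDegree_sub_C, natDegree_sub_eq_left_of_natDegree_lt] <;> simp; omega
  have e0 : (X ^ p - X - C (x ^ p - x) : K[X]).eval 0 = -(x ^ p - x) := by
    simp [hp.ne_zero]
  have key := h_C0 (h := (X ^ p - X - C (x ^ p - x) : K[X])) (N := p)
    (by intro h0; rw [h0] at hdeg; simp at hdeg; omega) hdeg (fun l => x + l * algebraMap F K j)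
    ?_ ?_ 0 (by rw [e0]; exact neg_ne_zero.2 hy)
  · rw [e0] at key
    have e1 : (X ^ p - X - C (x ^ p - x) : K[X]).derivative.eval 0 = -1 := by
      simp [derivative_pow]
    rw [e1] at key
    have : ∀ l ∈ Finset.range p, x⁻¹ ^ (Fintype.card F) ^ (t * l) =
        - (1 / (0 - (x + l * algebraMap F K j))) := by
      intro l _
      rw [inv_pow, h_shift_iter h]
      rw [zero_sub, one_div, inv_neg, neg_neg]
    rw [Finset.sum_congr rfl this, Finset.sum_neg_distrib, ← key]
    rw [neg_div_neg_eq, one_div]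
  · intro l _
    have hl : (l : K) ^ p = l := by
      have := map_natCast (frobenius K p) l
      rwa [frobenius_def] at this
    simp only [eval_sub, eval_pow, eval_X, eval_C]
    rw [add_pow_char, mul_pow, hl, hjp']; ring
  · intro a ha b hb hab
    have h2 : (a : K) = b := by
      have := add_left_cancel hab
      exact mul_right_cancel₀ (by simpa using hj) this
    have := (CharP.cast_eq_iff_mod_eq K p).1 h2
    rwa [Nat.mod_eq_of_lt ha, Nat.mod_eq_of_lt hb] at this

end steps
section main
universe v

/-- The invariant carried along the recursion. -/
def HInv {F : Type v} [Field F] [Fintype F] (p m k t : ℕ) (G : F[X]) : Prop :=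
  Irreducible G ∧ G.natDegree = t ∧
    TrQP p m (G.derivative.eval 0 / G.eval 0) ≠ 0 ∧
    TrQP p m (G.derivative.eval 1 / G.eval 1) ≠ 0 ∧
    ∀ (K : Type v) [Field K] [Algebra F K] (γ : K), aeval γ G = 0 →
      IsKNormalElem (Fintype.card F) t k γ⁻¹

theorem h_noroot {F : Type v} [Field F] {G : F[X]} (hG : Irreducible G) (h : 2 ≤ G.natDegree)
    (a : F) : G.eval a ≠ 0 := by
  intro h0
  have : G.natDegree = 1 := natDegree_eq_of_degree_eq_some (degree_eq_one_of_irreducible_of_root hG h0)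
  omega

theorem h_coeff0 {F : Type v} [Field F] {G : F[X]} (hG : Irreducible G) (h : 2 ≤ G.natDegree) :
    G.coeff 0 ≠ 0 := by
  rw [coeff_zero_eq_eval_zero]; exact h_noroot hG h 0

theorem h_natDegree_reflect {F : Type v} [Field F] {G : F[X]} {t : ℕ} (h0 : G.coeff 0 ≠ 0)
    (ht : G.natDegree = t) : (reflect t G).natDegree = t := by
  apply natDegree_eq_of_le_of_coeff_ne_zero
  · exact (natDegree_reflect_le).trans (by simp [ht])
  · rw [coeff_reflect, revAt_le le_rfl]; simpa using h0

theorem h_irr_reflect {F : Type v} [Field F] [Fintype F] {G : F[X]} {t : ℕ} (hG : Irreducible G)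
    (ht : G.natDegree = t) (h2 : 2 ≤ t) : Irreducible (reflect t G) := by
  have := Fact.mk hG
  have h0 := h_coeff0 hG (by omega)
  have hd := h_natDegree_reflect h0 ht
  have hr : aeval (AdjoinRoot.root G) G = 0 := AdjoinRoot.aeval_eq G ▸ AdjoinRoot.mk_self
  have hr0 : AdjoinRoot.root G ≠ 0 := by
    intro h
    rw [h, ← coeff_zero_eq_aeval_zero'] at hr
    simp [h0] at hr
  apply h_A (x := (AdjoinRoot.root G)⁻¹)
  · intro h; rw [h] at hd; simp at hd; omega
  · exact (h_reflect ht.le hr0).2 hr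
  · intro i hi
    rw [hd, ← ht, ← h_B hG hr]
    rw [inv_pow] at hi
    exact inv_injective hi

theorem h_final {F : Type v} [Field F] [Fintype F] {p m k t : ℕ} {G : F[X]} (h2 : 2 ≤ t)
    (h : HInv p m k t G) : IsNkPolynomial k t (reflect t G) := by
  obtain ⟨hG, ht, -, -, hK⟩ := h
  have h0 := h_coeff0 hG (by omega)
  refine ⟨h_irr_reflect hG ht h2, h_natDegree_reflect h0 ht, ?_⟩
  intro β hβ
  have hβ' := (mem_aroots.1 hβ).2
  have hβ0 : β ≠ 0 := by
    rintro rfl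
    rw [← coeff_zero_eq_aeval_zero', coeff_reflect, revAt_zero, ← ht] at hβ'
    simp [hG.ne_zero] at hβ'
  rw [← inv_inv β]
  apply hK
  rw [← h_reflect ht.le (inv_ne_zero hβ0), inv_inv]
  exact hβ'

theorem h_base {F : Type v} [Field F] [Fintype F] {p m k n : ℕ} {P : F[X]} (h2 : 2 ≤ n)
    (hP : IsNkPolynomial k n P)
    (htr : TrQP p m ((Polynomial.derivative (reflect n P)).eval 0 / (reflect n P).eval 0) *
        TrQP p m ((Polynomial.derivative (reflect n P)).eval 1 / (reflect n P).eval 1) ≠ 0) :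
    HInv p m k n (reflect n P) := by
  have hi := h_irr_reflect hP.1 hP.2.1 h2
  have h0 := h_coeff0 hP.1 (by rw [hP.2.1]; exact h2)
  have hd := h_natDegree_reflect h0 hP.2.1
  refine ⟨hi, hd, left_ne_zero_of_mul htr, right_ne_zero_of_mul htr, ?_⟩
  intro K _ _ γ hγ
  apply h_all hP
  have hγ0 : γ ≠ 0 := by
    rintro rfl
    rw [← coeff_zero_eq_aeval_zero'] at hγ
    have := h_coeff0 hi (by omega)
    exact this (by simpa only [map_eq_zero] using hγ)
  have := (h_reflect hd.le hγ0).2 hγ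
  have hinv : reflect n (reflect n P) = P := by
    ext i; simp [coeff_reflect]
  rwa [hinv] at this

theorem h_knormal {F K : Type*} [Field F] [Fintype F] [Field K] [Algebra F K] {p m k t r s : ℕ}
    (hp : p.Prime) [CharP F p] (hq : Fintype.card F = p ^ m) (ht : t = r * p ^ s) (ht2 : 2 ≤ t)
    (htp : (t : F) = 0) (hks : k < p ^ s) {δ : F} (hδ : δ ≠ 0) {α β : K}
    (hα : IsKNormalElem (Fintype.card F) t k α)
    (hw : ∑ i ∈ Finset.range t, α ^ (Fintype.card F) ^ i ≠ 0) {ξ : K}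
    (hβ : β = algebraMap F K δ⁻¹ * (1 - α))
    (hξ : ∑ l ∈ Finset.range p, ξ ^ (Fintype.card F) ^ (t * l) = β) :
    IsKNormalElem (Fintype.card F) (t * p) k ξ := by
  have := Fact.mk hp
  have : CharP K p := charP_of_injective_algebraMap' F p
  have ht0 : (t : K) = 0 := by
    have := congrArg (algebraMap F K) htp
    simpa using this
  let _ : DecidableEq K[X] := Classical.decEq _
  unfold IsKNormalElem at hα ⊢
  have hfr : ∀ i, ∑ l ∈ Finset.range p, ξ ^ (Fintype.card F) ^ (i + t * l) =
      β ^ (Fintype.card F) ^ i := by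
    intro i
    rw [← hξ, ← h_frob (F := F) i, map_sum]
    apply Finset.sum_congr rfl
    intro l _
    rw [h_frob, ← pow_mul, ← pow_add, add_comm]
  have hdvd := h_test (Fintype.card F) t p ξ β hfr
  have hM0 : (X ^ t - 1 : K[X]) ≠ 0 := (monic_X_pow_sub_C (1 : K) (by omega)).ne_zero
  have hM : (X ^ t - 1 : K[X]) = (X ^ r - 1) ^ p ^ s := by
    rw [sub_pow_char_pow, one_pow, ← pow_mul, ht]
  have hMp : (X ^ (t * p) - 1 : K[X]) = (X ^ t - 1) ^ p := by
    rw [sub_pow_char, one_pow, ← pow_mul]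
  have hone : kNormalTestPoly (Fintype.card F) t (1 : K) = ∑ i ∈ Finset.range t, X ^ i := by
    unfold kNormalTestPoly
    simp only [one_pow, map_one, one_mul]
    exact Finset.sum_range_reflect (fun i => (X : K[X]) ^ i) t
  have hβt : kNormalTestPoly (Fintype.card F) t β = C (algebraMap F K δ⁻¹) *
      (kNormalTestPoly (Fintype.card F) t (1 : K) - kNormalTestPoly (Fintype.card F) t α) := by
    unfold kNormalTestPoly
    rw [← Finset.sum_sub_distrib, Finset.mul_sum]
    apply Finset.sum_congr rfl
    intro i _
    have : β ^ (Fintype.card F) ^ i = algebraMap F K δ⁻¹ * (1 - α ^ (Fintype.card F) ^ i) := by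
      rw [hβ, ← h_frob (F := F) i, ← h_frob (F := F) i, map_mul, map_sub, map_one, AlgHom.commutes]
    rw [this, one_pow, ← sub_mul, ← mul_assoc, ← C_sub, ← C_mul]
  have e3 := h_gcd3 (M := (X ^ t - 1 : K[X])) (Ψ := kNormalTestPoly (Fintype.card F) t (1 : K))
    (w := kNormalTestPoly (Fintype.card F) t α) (c := algebraMap F K δ⁻¹)
    (by simpa using hδ)
    (by rw [hone, map_one, mul_geom_sum])
    (by simpa [kNormalTestPoly, eval_finsetSum] using hw)
    (by rw [hone]; simp [eval_finsetSum, ht0])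
  have e1 := h_gcd1 hdvd
  rw [hβt, e3, hα] at e1
  rw [hMp, h_gcd2 hp.ne_zero hM0 hM (by rw [e1]; exact hks), e1]

theorem h_step {F : Type v} [Field F] [Fintype F] {p m k t r s : ℕ} (hp : p.Prime) [CharP F p]
    (hq : Fintype.card F = p ^ m) (ht : t = r * p ^ s) (ht2 : 2 ≤ t) (htp : (t : F) = 0)
    (hks : k < p ^ s) {δ : F} (hδ : δ ≠ 0) (hδp : δ ^ p = δ) {G : F[X]} (h : HInv p m k t G) :
    HInv p m k (t * p) (compSubstAS p δ t G) := by
  obtain ⟨hG, hGt, tr0, tr1, hK⟩ := h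
  have h0 := h_noroot hG (by omega) 0
  have h1 := h_noroot hG (by omega) 1
  have hc0 := h_coeff0 hG (by omega)
  have hd := h_comp_deg hp.two_le δ t hGt.le h1
  have hd0 : 0 < t * p := Nat.mul_pos (by omega) hp.pos
  set j := δ * TrQP p m (G.derivative.eval 1 / G.eval 1) with hj
  have hj0 : j ≠ 0 := mul_ne_zero hδ tr1
  have hjp : j ^ p = j := by rw [hj, mul_pow, hδp, h_tr_pow hp hq]
  have hδi : (-δ⁻¹) ^ p = -δ⁻¹ := by
    have := Fact.mk hp
    rw [neg_inv, inv_pow]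
    have : (-δ) ^ p = -δ := by
      have := map_neg (frobenius F p) δ
      rwa [frobenius_def, frobenius_def, hδp] at this
    rw [this]
  have htr : ∀ a : F, a ^ p = a → TrQP p m ((compSubstAS p δ t G).derivative.eval a /
      (compSubstAS p δ t G).eval a) ≠ 0 := by
    intro a ha
    rw [h_comp_ratio hδ (by omega) htp a ha, h_tr_mul hδi]
    exact mul_ne_zero (by simpa using hδ) tr0
  refine ⟨?_, hd, htr 0 (by simp [hp.ne_zero]), htr 1 (by simp), ?_⟩
  · have hne : compSubstAS p δ t G ≠ 0 := by
      intro h; rw [h, natDegree_zero] at hd; rw [← hd] at hd0; exact lt_irrefl _ hd0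
    have hs := SplittingField.splits (compSubstAS p δ t G)
    obtain ⟨x, hx⟩ := hs.exists_eval_eq_zero (by
      rw [degree_map]; exact (natDegree_pos_iff_degree_pos.1 (hd.symm ▸ hd0)).ne')
    rw [eval_map_algebraMap] at hx
    obtain ⟨hy, hz, hγ⟩ := h_comp_root hGt hc0 hδ hx
    have hsh := h_shift hp hq hG hGt htp h1 hδ hδp hz hγ
    apply h_A hne hx
    intro i hi
    rw [hd]
    exact h_order hp hG hGt hj0 hγ hsh i hi
  · intro K _ _ x hx
    obtain ⟨hy, hz, hγ⟩ := h_comp_root hGt hc0 hδ hx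
    have hsh := h_shift hp hq hG hGt htp h1 hδ hδp hz hγ
    have hξ := h_trace hp hj0 hjp hy hsh
    have hδ' : algebraMap F K δ ≠ 0 := by simpa using hδ
    refine h_knormal hp hq ht ht2 htp hks hδ (hK K _ hγ) ?_ ?_ hξ
    · have hC := h_C hG hγ 0 h0
      rw [hGt] at hC
      intro hzero
      have : algebraMap F K (G.derivative.eval 0 / G.eval 0) = 0 := by
        rw [← hC, ← neg_eq_zero, ← hzero, ← Finset.sum_neg_distrib]
        apply Finset.sum_congr rfl
        intro i _
        rw [map_zero, zero_sub, one_div, inv_neg, neg_neg, inv_pow]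
      have h3 : G.derivative.eval 0 / G.eval 0 = 0 := by simpa only [map_eq_zero] using this
      apply tr0
      rw [h3]
      unfold TrQP
      apply Finset.sum_eq_zero
      intro i _
      exact zero_pow (pow_ne_zero _ hp.ne_zero)
    · rw [map_inv₀, inv_div]
      field_simp
      ring

end main

/-- Theorem 3.2: with `q = p^m`, `n = r·p^e` (`e ≥ 1`, `r = 1` or a prime
`≠ p` with `q` a primitive root mod `r`), `P` a `k`-normal polynomial of degree `n`
over `F_q`, and `δ` a nonzero element of the prime field `F_p ⊆ F_q`: define
`F₀ = P*` and `F_u = (x^p-x+δ)^{n·p^{u-1}} F_{u-1}((x^p-x)/(x^p-x+δ))`. If `k < p^e`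
and `Tr_{q|p}((P*)'(0)/P*(0)) · Tr_{q|p}((P*)'(1)/P*(1)) ≠ 0`, then for every `u ≥ 0`
the reciprocal `F_u*` is a `k`-normal polynomial of degree `n·p^u` over `F_q`. -/
theorem reflect_FseqAS_isNkPolynomial
    {F : Type*} [Field F] [Fintype F] (p m e r n k : ℕ) (hp : p.Prime) (hm : 0 < m)
    (hq : Fintype.card F = p ^ m) (he : 1 ≤ e)
    (hr : r = 1 ∨ (r.Prime ∧ r ≠ p ∧ orderOf ((p ^ m : ℕ) : ZMod r) = r - 1))
    (hn : n = r * p ^ e)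
    (P : Polynomial F) (hP : IsNkPolynomial k n P)
    (δ : F) (hδ : δ ≠ 0) (hδp : δ ^ p = δ)
    (hk : k < p ^ e)
    (htr : TrQP p m ((Polynomial.derivative (reflect n P)).eval 0 / (reflect n P).eval 0) *
        TrQP p m ((Polynomial.derivative (reflect n P)).eval 1 / (reflect n P).eval 1) ≠ 0) :
    ∀ u : ℕ, IsNkPolynomial k (n * p ^ u)
      (reflect (n * p ^ u) (FseqAS p δ n (reflect n P) u)) := by

  have hchar : CharP F p := by
    have := Fact.mk hp
    obtain ⟨p', hp'⟩ := CharP.exists F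
    have hpp := CharP.char_is_prime F p'
    obtain ⟨a, h1, h2⟩ := FiniteField.card F p'
    rw [hq] at h2
    have : p = p' := by
      have h3 : p ∣ p' ^ (a : ℕ) := h2 ▸ dvd_pow_self p hm.ne'
      exact (Nat.prime_dvd_prime_iff_eq hp h1).1 (hp.dvd_of_dvd_pow h3)
    rw [this]; exact hp'
  have hr0 : 1 ≤ r := by
    rcases hr with h | h
    · omega
    · exact h.1.pos
  have hpe : 2 ≤ p ^ e := hp.two_le.trans (Nat.le_self_pow (by omega) p)
  have hn2 : 2 ≤ n := by rw [hn]; nlinarith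
  have hpn : p ∣ n := by rw [hn]; exact Dvd.dvd.mul_left (dvd_pow_self p (by omega)) r
  have hpu : ∀ u, 1 ≤ p ^ u := fun u => Nat.pos_of_ne_zero (pow_ne_zero u hp.ne_zero)
  have ht2 : ∀ u, 2 ≤ n * p ^ u := fun u => by nlinarith [hpu u]
  have hinv : ∀ u, HInv p m k (n * p ^ u) (FseqAS p δ n (reflect n P) u) := by
    intro u
    induction u with
    | zero => simpa [FseqAS] using h_base hn2 hP htr
    | succ u ih =>
      rw [pow_succ, ← mul_assoc]
      refine h_step (r := r) (s := e + u) hp hq (by rw [hn, pow_add, mul_assoc]) (ht2 u) ?_ ?_ hδ hδp ih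
      · exact (CharP.cast_eq_zero_iff F p _).2 (hpn.mul_right _)
      · exact hk.trans_le (Nat.pow_le_pow_right hp.pos (by omega))
  intro u
  exact h_final (ht2 u) (hinv u)
end

section
/- Let q = p^m with p prime, let P be an irreducible polynomial of degree n over F_q, let δ ∈ F_q*, and set F(x) = (x^p − x + δ)^n · P*((x^p − x)/(x^p − x + δ)), where P* is the reciprocal polynomial of P. Assume F is irreducible of degree np over F_q, and let α₁ ∈ F_{q^{np}} be a root of F. Then θ := α₁^{q^n} − α₁ is a nonzero element of the prime field F_p, and for every j with 1 ≤ j ≤ p−1, α₁^{q^{jn}} = α₁ + jθ. -/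
open Polynomial

/-- equations (15)–(18) in the proof of Theorem 3.1: with `q = p^m`,
`P` irreducible of degree `n` over `F_q`, `δ ∈ F_q^*`,
`F = (x^p - x + δ)^n P*((x^p - x)/(x^p - x + δ))` (`P* = reflect n P` the reciprocal of
`P`) assumed irreducible of degree `np`, and `α₁ ∈ F_{q^{np}}` a root of `F`:
the element `θ := α₁^{q^n} - α₁` is a nonzero element of the prime field `F_p`
(`θ ≠ 0` and `θ^p = θ`), and `α₁^{q^{jn}} = α₁ + jθ` for `1 ≤ j ≤ p-1`. -/
theorem root_frobenius_orbit_compSubstAS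
    {F E : Type*} [Field F] [Fintype F] [Field E] [Fintype E] [Algebra F E]
    (p m n : ℕ) (hp : p.Prime) (hm : 0 < m)
    (hq : Fintype.card F = p ^ m)
    (P : Polynomial F) (hPirr : Irreducible P) (hPdeg : P.natDegree = n)
    (δ : F) (hδ : δ ≠ 0)
    (hFirr : Irreducible (compSubstAS p δ n (reflect n P)))
    (hFdeg : (compSubstAS p δ n (reflect n P)).natDegree = n * p)
    (hE : Fintype.card E = (p ^ m) ^ (n * p))
    (α₁ : E) (hroot : Polynomial.aeval α₁ (compSubstAS p δ n (reflect n P)) = 0) :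
    α₁ ^ (p ^ m) ^ n - α₁ ≠ 0 ∧
      (α₁ ^ (p ^ m) ^ n - α₁) ^ p = α₁ ^ (p ^ m) ^ n - α₁ ∧
      ∀ j : ℕ, 1 ≤ j → j ≤ p - 1 →
        α₁ ^ (p ^ m) ^ (j * n) = α₁ + (j : E) * (α₁ ^ (p ^ m) ^ n - α₁) := by
  have hpf : Fact p.Prime := ⟨hp⟩
  have hcharF : CharP F p := by
    obtain ⟨c, hc⟩ := CharP.exists F
    obtain ⟨k, hcp, hk⟩ := FiniteField.card F c
    have h1 : c ∣ p ^ m := by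
      rw [← hq, hk]
      exact dvd_pow_self c k.pos.ne'
    have h2 : c = p := (Nat.prime_dvd_prime_iff_eq hcp hp).1 (hcp.dvd_of_dvd_pow h1)
    exact h2 ▸ hc
  have hcharE : CharP E p := charP_of_injective_algebraMap (algebraMap F E).injective p
  have hcard : Nat.card F = p ^ m := by rw [Nat.card_eq_fintype_card, hq]
  have hn : 0 < n := hPdeg ▸ hPirr.natDegree_pos
  obtain ⟨φ, hφ⟩ : ∃ φ : E →+* E, ∀ x, φ x = x ^ (p ^ m) ^ n :=
    ⟨iterateFrobenius E p (m * n), fun x => by rw [iterateFrobenius_def, pow_mul]⟩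
  have hφF : ∀ x : F, φ (algebraMap F E x) = algebraMap F E x := fun x => by
    rw [hφ, ← map_pow, ← hq, FiniteField.pow_card_pow]
  set d : E := algebraMap F E δ with hd
  have hd0 : d ≠ 0 := by simpa [hd] using hδ
  set β : E := α₁ ^ p - α₁ with hβ
  have hsum : ∑ i ∈ Finset.range (n + 1),
      algebraMap F E (P.coeff i) * β ^ (n - i) * (β + d) ^ i = 0 := by
    rw [← Finset.sum_range_reflect, ← hroot, compSubstAS, map_sum]
    refine Finset.sum_congr rfl fun i hi => ?_
    have hi' : i ≤ n := by simpa [Nat.lt_succ_iff] using hi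
    rw [coeff_reflect, revAt_le hi']
    have e1 : n + 1 - 1 - i = n - i := by omega
    have e2 : n - (n - i) = i := by omega
    simp [e1, e2, hβ, hd]
  have hβ0 : β ≠ 0 := by
    intro h0
    rw [Finset.sum_range_succ, Finset.sum_eq_zero] at hsum
    · have : P.coeff n ≠ 0 := by
        rw [← hPdeg]
        exact leadingCoeff_ne_zero.2 hPirr.ne_zero
      simp [h0, hd0, this] at hsum
    · intro i hi
      have : n - i ≠ 0 := by
        have := Finset.mem_range.1 hi
        omega
      simp [h0, this]
  have hu : aeval ((β + d) / β) P = 0 := by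
    rw [aeval_eq_sum_range, hPdeg]
    have : β ^ n * ∑ i ∈ Finset.range (n + 1), P.coeff i • ((β + d) / β) ^ i = 0 := by
      rw [← hsum, Finset.mul_sum]
      refine Finset.sum_congr rfl fun i hi => ?_
      have hi' : i ≤ n := by simpa [Nat.lt_succ_iff] using hi
      rw [Algebra.smul_def, div_pow]
      have : β ^ n = β ^ (n - i) * β ^ i := by rw [← pow_add]; congr 1; omega
      rw [this]
      field_simp
    exact (mul_eq_zero.1 this).resolve_left (pow_ne_zero _ hβ0)
  have hφu : φ ((β + d) / β) = (β + d) / β := by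
    have h1 : P ∣ X ^ (Nat.card F) ^ n - X :=
      (hPirr.natDegree_dvd_iff_dvd_X_pow_card_pow_sub_X).1 (by rw [hPdeg])
    have h2 := aeval_eq_zero_of_dvd_aeval_eq_zero h1 hu
    rw [hcard] at h2
    rw [hφ]
    simpa [sub_eq_zero] using h2
  have hφβ : φ β = β := by
    have hφβ0 : φ β ≠ 0 := by simpa using hβ0
    rw [map_div₀, map_add, hφF, div_eq_div_iff hφβ0 hβ0] at hφu
    have : d * (φ β - β) = 0 := by linear_combination -hφu
    exact sub_eq_zero.1 ((mul_eq_zero.1 this).resolve_left hd0)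
  have hθ : (φ α₁ - α₁) ^ p = φ α₁ - α₁ := by
    rw [sub_pow_char]
    rw [hβ, map_sub, map_pow] at hφβ
    linear_combination hφβ
  have hθ2 : φ (φ α₁ - α₁) = φ α₁ - α₁ := by
    rw [hφ (φ α₁ - α₁), ← pow_mul]
    generalize m * n = k
    induction k with
    | zero => simp
    | succ k ih => rw [pow_succ, pow_mul, ih, hθ]
  rw [← hφ α₁]
  refine ⟨?_, hθ, ?_⟩
  · intro h0
    rw [hφ, ← hcard] at h0
    have h1 : compSubstAS p δ n (reflect n P) ∣ X ^ (Nat.card F) ^ n - X := by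
      have h2 : minpoly F α₁ ∣ X ^ (Nat.card F) ^ n - X := minpoly.dvd _ _ (by simpa using h0)
      have h3 : minpoly F α₁ ∣ compSubstAS p δ n (reflect n P) := minpoly.dvd _ _ hroot
      exact ((minpoly.irreducible (Algebra.IsIntegral.isIntegral α₁)).dvd_symm hFirr h3).trans h2
    have h4 := hFirr.natDegree_dvd_of_dvd_X_pow_card_pow_sub_X h1
    rw [hFdeg] at h4
    have h5 := Nat.le_of_dvd hn h4
    have := hp.two_le
    nlinarith
  · intro j _ _
    clear * - hφ hθ2
    induction j with
    | zero => simp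
    | succ j ih =>
      rw [add_mul, one_mul, pow_add, pow_mul, ih, ← hφ, map_add, map_mul, hθ2, map_natCast]
      push_cast
      ring
end
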